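/- Let λ, μ, ν be partitions with at most k parts such that |ν| = |λ| + |μ|. Then C^ν_{λ,μ} = Σ_{σ,τ ∈ S_k} (−1)^{inv(στ)} K(σ(λ+δ) + τ(μ+δ) − (ν+2δ)), where the sum is over all pairs of permutations σ, τ of {1,…,k}, inv(ψ) is the number of inversions of the permutation ψ, permutations act on vectors in R^k by permuting coordinates, and δ = (1/2)(k−1, k−3, …, −(k−3), −(k−1)). -/

import Mathlib

/-- The alternant `a_α = Σ_σ sign(σ) Π_i x_{σ(i)}^{α_i}` in `k` variables. -/
noncomputable def alternant (k : ℕ) (α : Fin k → ℕ) : MvPolynomial (Fin k) ℤ :=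
  ∑ σ : Equiv.Perm (Fin k),
    (Equiv.Perm.sign σ : ℤ) • ∏ i : Fin k, (MvPolynomial.X (σ i)) ^ (α i)

/-- The staircase vector `δ = (k-1, k-2, …, 1, 0)`. -/
def staircase (k : ℕ) : Fin k → ℕ := fun i => k - 1 - (i : ℕ)

/-- `lr` is the family of Littlewood-Richardson coefficients (for partitions with at most
`k` parts): `lr ν λ μ = C^ν_{λ,μ}` is supported on partitions `ν` with `|ν| = |λ| + |μ|`,
and satisfies the defining Schur-function expansion `S_λ · S_μ = Σ_ν C^ν_{λ,μ} S_ν`,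
expressed equivalently via alternants as
`a_{λ+δ} · a_{μ+δ} = a_δ · Σ_ν C^ν_{λ,μ} a_{ν+δ}`. -/
def IsLRCoeffFamily (k : ℕ) (lr : (Fin k → ℕ) → (Fin k → ℕ) → (Fin k → ℕ) → ℕ) : Prop :=
  (∀ ν lam mu : Fin k → ℕ, lr ν lam mu ≠ 0 →
      Antitone ν ∧ ∑ i, ν i = ∑ i, lam i + ∑ i, mu i) ∧
  (∀ lam mu : Fin k → ℕ, Antitone lam → Antitone mu →
    alternant k (lam + staircase k) * alternant k (mu + staircase k) =
      alternant k (staircase k) *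
        ∑ᶠ ν : Fin k → ℕ, lr ν lam mu • alternant k (ν + staircase k))


/-- The Kostant partition function for the root system of type `A_{k-1}`: `kostant k v` is
the number of ways to write `v` as a nonnegative integer combination of the positive roots
`e_i - e_j`, `i < j` (and it is `0` if `v` is not an integer vector).  A combination is
recorded as a matrix `b` of nonnegative integers supported on pairs `(i, j)` with `i < j`;
the coordinate `i` of `Σ_{i<j} b_{ij} (e_i - e_j)` is `Σ_j b_{ij} - Σ_j b_{ji}`. -/
noncomputable def kostant (k : ℕ) (v : Fin k → ℚ) : ℕ :=
  Nat.card {b : Fin k × Fin k → ℕ //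
    (∀ p : Fin k × Fin k, ¬ p.1 < p.2 → b p = 0) ∧
    ∀ i : Fin k, (∑ j : Fin k, (b (i, j) : ℚ)) - (∑ j : Fin k, (b (j, i) : ℚ)) = v i}

/-- The number of inversions of a permutation of `{0, …, k-1}`. -/
def inversions {k : ℕ} (ψ : Equiv.Perm (Fin k)) : ℕ :=
  (Finset.univ.filter fun p : Fin k × Fin k => p.1 < p.2 ∧ ψ p.2 < ψ p.1).card

/-- The half-sum of positive roots `δ = (1/2)(k-1, k-3, …, -(k-3), -(k-1))`. -/
noncomputable def halfδ (k : ℕ) : Fin k → ℚ := fun i => ((k : ℚ) - 1) / 2 - (i : ℕ)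

/-- The vector `e_i - e_j` attached to a pair `p = (i, j)`. -/
def rootVec {k : ℕ} (p : Fin k × Fin k) : Fin k → ℤ :=
  Pi.single p.1 1 - Pi.single p.2 1

/-- The ways to write `v` as a nonnegative integer combination of the vectors `e_i - e_j` with
`(i, j) ∈ S`. -/
def partitionSet {k : ℕ} (S : Finset (Fin k × Fin k)) (v : Fin k → ℤ) :
    Set (Fin k × Fin k → ℕ) :=
  {b | (∀ p, p ∉ S → b p = 0) ∧ ∑ p, b p • rootVec p = v}

/-- The index pairs of the positive roots. -/
def positivePairs (k : ℕ) : Finset (Fin k × Fin k) :=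
  Finset.univ.filter fun p => p.1 < p.2

theorem sum_smul_rootVec_apply {k : ℕ} (b : Fin k × Fin k → ℕ) (i : Fin k) :
    (∑ p, b p • rootVec p) i = (∑ j, (b (i, j) : ℤ)) - ∑ j, (b (j, i) : ℤ) := by
  simp only [rootVec, Finset.sum_apply, Pi.sub_apply, nsmul_eq_mul, mul_sub,
    Finset.sum_sub_distrib]
  congr 1
  · rw [Fintype.sum_prod_type_right]
    simp [Pi.single_apply]
  · rw [Fintype.sum_prod_type]
    simp [Pi.single_apply]

theorem partitionSet_finite {k : ℕ} {S : Finset (Fin k × Fin k)} (hS : S ⊆ positivePairs k)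
    (v : Fin k → ℤ) : (partitionSet S v).Finite := by
  refine (Set.finite_Iic
    (fun _ : Fin k × Fin k => (-∑ i : Fin k, (i : ℤ) * v i).toNat)).subset ?_
  rintro b ⟨hb, hv⟩ p
  have height : ∑ p : Fin k × Fin k, (b p : ℤ) * ((p.2 : ℤ) - p.1) = -∑ i : Fin k, (i : ℤ) * v i := by
    subst hv
    simp only [sum_smul_rootVec_apply, mul_sub, Finset.sum_sub_distrib, Finset.mul_sum,
      neg_sub]
    congr 1
    · rw [Fintype.sum_prod_type_right]
      simp [mul_comm]
    · rw [Fintype.sum_prod_type]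
      simp [mul_comm]
  have term : ∀ q : Fin k × Fin k, (b q : ℤ) ≤ b q * ((q.2 : ℤ) - q.1) := by
    intro q
    by_cases hq : q ∈ S
    · have : q.1 < q.2 := by simpa [positivePairs] using hS hq
      have h1 : (1 : ℤ) ≤ (q.2 : ℤ) - q.1 := by
        have : (q.1 : ℕ) < q.2 := this
        omega
      nlinarith [Int.natCast_nonneg (b q)]
    · simp [hb q hq]
  have : (b p : ℤ) ≤ -∑ i : Fin k, (i : ℤ) * v i := by
    rw [← height]
    exact (term p).trans (Finset.single_le_sum
      (f := fun q : Fin k × Fin k => (b q : ℤ) * ((q.2 : ℤ) - q.1))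
      (fun q _ => (Int.natCast_nonneg _).trans (term q)) (Finset.mem_univ p))
  show b p ≤ (-∑ i : Fin k, (i : ℤ) * v i).toNat
  omega

theorem ncard_partitionSet_insert {k : ℕ} {S : Finset (Fin k × Fin k)} {p : Fin k × Fin k}
    (hp : p ∉ S) (hS : insert p S ⊆ positivePairs k) (v : Fin k → ℤ) :
    (partitionSet (insert p S) v).ncard =
      (partitionSet S v).ncard + (partitionSet (insert p S) (v - rootVec p)).ncard := by
  have hunion : partitionSet (insert p S) v =
      partitionSet S v ∪ (· + Pi.single p 1) '' partitionSet (insert p S) (v - rootVec p) := by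
    have hsingle : ∑ q, (Pi.single p 1 : Fin k × Fin k → ℕ) q • rootVec q = rootVec p := by
      simp [Pi.single_apply]
    ext b
    constructor
    · rintro ⟨hb, hv⟩
      by_cases hbp : b p = 0
      · refine Or.inl ⟨fun q hq => ?_, hv⟩
        by_cases hqp : q = p
        · rwa [hqp]
        · exact hb q (by simp [hq, hqp])
      · have hle : Pi.single p 1 ≤ b := by
          intro q
          by_cases hqp : q = p
          · subst hqp
            simp
            omega
          · simp [hqp]
        refine Or.inr ⟨b - Pi.single p 1, ⟨fun q hq => ?_, ?_⟩, tsub_add_cancel_of_le hle⟩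
        · simp [hb q hq]
        · rw [eq_sub_iff_add_eq, ← hsingle, ← Finset.sum_add_distrib, ← hv]
          refine Finset.sum_congr rfl fun q _ => ?_
          rw [← add_smul, ← Pi.add_apply, tsub_add_cancel_of_le hle]
    · rintro (⟨hb, hv⟩ | ⟨b, ⟨hb, hv⟩, rfl⟩)
      · exact ⟨fun q hq => hb q fun h => hq (Finset.mem_insert_of_mem h), hv⟩
      · refine ⟨fun q hq => ?_, ?_⟩
        · have hqp : q ≠ p := fun h => hq (h ▸ Finset.mem_insert_self p S)
          simp [hb q hq, hqp]
        · simp only [Pi.add_apply, add_smul, Finset.sum_add_distrib, hv, hsingle,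
            sub_add_cancel]
  have hdisj : Disjoint (partitionSet S v)
      ((· + Pi.single p 1) '' partitionSet (insert p S) (v - rootVec p)) := by
    rw [Set.disjoint_left]
    rintro _ hb ⟨b, -, rfl⟩
    have := hb.1 p hp
    simp at this
  rw [hunion, Set.ncard_union_eq hdisj
    (partitionSet_finite ((Finset.subset_insert p S).trans hS) v)
    ((partitionSet_finite hS _).image _),
    Set.ncard_image_of_injective _ (add_left_injective _)]

theorem ncard_partitionSet_empty {k : ℕ} (v : Fin k → ℤ) :
    (partitionSet ∅ v).ncard = if v = 0 then 1 else 0 := by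
  have h : partitionSet ∅ v = if v = 0 then {0} else ∅ := by
    ext b
    have hb : (∀ p, p ∉ (∅ : Finset (Fin k × Fin k)) → b p = 0) ↔ b = 0 := by
      simp [funext_iff]
    rw [partitionSet, Set.mem_ofPred_eq, hb]
    split_ifs with hv
    · simp only [Set.mem_singleton_iff, and_iff_left_iff_imp]
      rintro rfl
      simp [hv]
    · simp only [Set.mem_empty_iff_false, iff_false, not_and]
      rintro rfl h
      exact hv (by simpa using h.symm)
  rw [h]
  split_ifs <;> simp

theorem kostant_intCast {k : ℕ} (v : Fin k → ℤ) :
    kostant k (fun i => (v i : ℚ)) = (partitionSet (positivePairs k) v).ncard := by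
  rw [kostant, ← Nat.card_coe_set_eq]
  refine Nat.card_congr (Equiv.subtypeEquivRight fun b => ?_)
  refine and_congr (by simp [positivePairs]) ?_
  rw [funext_iff]
  refine forall_congr' fun i => ?_
  rw [sum_smul_rootVec_apply, ← Int.cast_inj (α := ℚ)]
  push_cast
  rfl

/-- The linear functional on polynomials sending the monomial `x^m` to the number of ways of
writing `m - w` in terms of the roots indexed by `S`. -/
noncomputable def partitionFunctional {k : ℕ} (S : Finset (Fin k × Fin k)) (w : Fin k → ℤ) :
    MvPolynomial (Fin k) ℤ →ₗ[ℤ] ℤ :=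
  (MvPolynomial.basisMonomials (Fin k) ℤ).constr ℤ
    fun m => ((partitionSet S fun i => (m i : ℤ) - w i).ncard : ℤ)

theorem partitionFunctional_monomial {k : ℕ} (S : Finset (Fin k × Fin k)) (w : Fin k → ℤ)
    (m : Fin k →₀ ℕ) :
    partitionFunctional S w (MvPolynomial.monomial m 1) =
      ((partitionSet S fun i => (m i : ℤ) - w i).ncard : ℤ) := by
  simpa [partitionFunctional] using (MvPolynomial.basisMonomials (Fin k) ℤ).constr_basis ℤ
    (fun m => ((partitionSet S fun i => (m i : ℤ) - w i).ncard : ℤ)) m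

theorem partitionFunctional_X_sub_X_mul {k : ℕ} {S : Finset (Fin k × Fin k)}
    {p : Fin k × Fin k} (hp : p ∉ S) (hS : insert p S ⊆ positivePairs k) (w : Fin k → ℤ)
    (P : MvPolynomial (Fin k) ℤ) :
    partitionFunctional (insert p S) w ((MvPolynomial.X p.1 - MvPolynomial.X p.2) * P) =
      partitionFunctional S (w - Pi.single p.1 1) P := by
  suffices h : partitionFunctional (insert p S) w ∘ₗ
      LinearMap.mulLeft ℤ (MvPolynomial.X p.1 - MvPolynomial.X p.2) =
      partitionFunctional S (w - Pi.single p.1 1) from LinearMap.congr_fun h P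
  refine (MvPolynomial.basisMonomials (Fin k) ℤ).ext fun m => ?_
  have hX : ∀ i : Fin k, MvPolynomial.X i * MvPolynomial.monomial m (1 : ℤ) =
      MvPolynomial.monomial (Finsupp.single i 1 + m) 1 := by
    intro i
    rw [MvPolynomial.X, MvPolynomial.monomial_mul, one_mul]
  simp only [MvPolynomial.coe_basisMonomials, LinearMap.comp_apply, LinearMap.mulLeft_apply,
    sub_mul, hX, map_sub, partitionFunctional_monomial]
  rw [ncard_partitionSet_insert hp hS, Nat.cast_add]
  have h1 : (fun i => (((Finsupp.single p.1 1 + m : Fin k →₀ ℕ) i : ℕ) : ℤ) - w i) =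
      fun i => (m i : ℤ) - (w - Pi.single p.1 1 : Fin k → ℤ) i := by
    ext i
    simp [Finsupp.single_apply, Pi.single_apply, eq_comm]
    ring
  have h2 : (fun i => (((Finsupp.single p.1 1 + m : Fin k →₀ ℕ) i : ℕ) : ℤ) - w i) - rootVec p =
      fun i => (((Finsupp.single p.2 1 + m : Fin k →₀ ℕ) i : ℕ) : ℤ) - w i := by
    ext i
    simp [rootVec, Finsupp.single_apply, Pi.single_apply, eq_comm]
    ring
  rw [h2, h1]
  ring

theorem partitionFunctional_prod_mul {k : ℕ} {S : Finset (Fin k × Fin k)}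
    (hS : S ⊆ positivePairs k) (w : Fin k → ℤ) (P : MvPolynomial (Fin k) ℤ) :
    partitionFunctional S w ((∏ p ∈ S, (MvPolynomial.X p.1 - MvPolynomial.X p.2)) * P) =
      partitionFunctional ∅ (w - ∑ p ∈ S, Pi.single p.1 1) P := by
  induction S using Finset.induction_on generalizing w with
  | empty => simp
  | insert p S hp ih =>
    rw [Finset.prod_insert hp, mul_assoc, partitionFunctional_X_sub_X_mul hp hS,
      ih ((Finset.subset_insert p S).trans hS), Finset.sum_insert hp, sub_sub]

theorem alternant_staircase (k : ℕ) :
    alternant k (staircase k) =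
      ∏ p ∈ positivePairs k, (MvPolynomial.X p.1 - MvPolynomial.X p.2) := by
  have h := Matrix.det_projVandermonde (fun _ : Fin k => (1 : MvPolynomial (Fin k) ℤ))
    MvPolynomial.X
  rw [Matrix.det_apply] at h
  rw [positivePairs, Finset.prod_filter, Fintype.prod_prod_type]
  refine Eq.trans ?_ (h.trans ?_)
  · refine Finset.sum_congr rfl fun σ _ => ?_
    rw [Units.smul_def]
    congr 1
    refine Finset.prod_congr rfl fun i _ => ?_
    rw [Matrix.projVandermonde_apply, one_pow, one_mul, Fin.val_rev, staircase]
    congr 1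
    omega
  · refine Finset.prod_congr rfl fun i _ => ?_
    rw [← Finset.prod_filter]
    refine Finset.prod_congr (by ext; simp) fun j _ => by ring

theorem sum_positivePairs_single (k : ℕ) :
    ∑ p ∈ positivePairs k, (Pi.single p.1 1 : Fin k → ℤ) = fun i => (staircase k i : ℤ) := by
  ext i
  rw [positivePairs, Finset.sum_filter, Fintype.sum_prod_type, Finset.sum_apply,
    Finset.sum_eq_single i]
  · rw [← Finset.sum_filter]
    simp only [Finset.sum_const, Finset.filter_lt_eq_Ioi, Fin.card_Ioi, staircase]
    simp
  · intro j _ hj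
    rw [Finset.sum_apply]
    refine Finset.sum_eq_zero fun c _ => ?_
    split_ifs <;> simp [hj.symm]
  · simp

theorem prod_X_pow_perm {k : ℕ} (σ : Equiv.Perm (Fin k)) (α : Fin k → ℕ) :
    ∏ i, (MvPolynomial.X (σ i) : MvPolynomial (Fin k) ℤ) ^ α i =
      MvPolynomial.monomial (Finsupp.equivFunOnFinite.symm (α ∘ σ.symm)) 1 := by
  rw [MvPolynomial.monomial_eq, Finsupp.prod_fintype _ _ (by simp), map_one, one_mul]
  exact Fintype.prod_equiv σ _ _ fun i => by simp

theorem alternant_eq_sum_monomial {k : ℕ} (α : Fin k → ℕ) :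
    alternant k α = ∑ σ : Equiv.Perm (Fin k), (Equiv.Perm.sign σ : ℤ) •
      MvPolynomial.monomial (Finsupp.equivFunOnFinite.symm (α ∘ σ)) (1 : ℤ) := by
  rw [alternant, ← Equiv.sum_comp (Equiv.inv (Equiv.Perm (Fin k)))]
  refine Finset.sum_congr rfl fun σ _ => ?_
  rw [prod_X_pow_perm, Equiv.inv_apply, Equiv.Perm.sign_inv]
  rfl

theorem neg_one_pow_inversions {k : ℕ} (ψ : Equiv.Perm (Fin k)) :
    (-1 : ℤ) ^ inversions ψ = Equiv.Perm.sign ψ := by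
  rw [Equiv.Perm.sign_eq_prod_prod_Ioi, inversions, ← Finset.prod_const, Finset.prod_filter,
    Fintype.prod_prod_type]
  push_cast
  refine Finset.prod_congr rfl fun i _ => ?_
  simp only [ite_and]
  rw [← Finset.prod_filter, Finset.filter_lt_eq_Ioi]
  refine Finset.prod_congr rfl fun j hj => ?_
  have hne : ψ i ≠ ψ j := fun h => (Finset.mem_Ioi.1 hj).ne (ψ.injective h)
  rcases lt_or_gt_of_ne hne with h | h <;> simp [h, h.not_gt]

theorem strictAnti_add_staircase {k : ℕ} {α : Fin k → ℕ} (hα : Antitone α) :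
    StrictAnti (α + staircase k) := by
  intro i j hij
  have h := hα hij.le
  have : (i : ℕ) < j := hij
  simp only [Pi.add_apply, staircase]
  omega

theorem comp_perm_eq_iff {k : ℕ} {α β : Fin k → ℕ} (hα : StrictAnti α) (hβ : StrictAnti β)
    (σ : Equiv.Perm (Fin k)) : α ∘ σ = β ↔ σ = 1 ∧ α = β := by
  refine ⟨fun h => ?_, by rintro ⟨rfl, rfl⟩; rfl⟩
  have hσ : StrictMono σ := fun i j hij => by
    rw [← hα.lt_iff_gt]
    simpa [← h] using hβ hij
  have h1 : σ = 1 := Equiv.coe_fn_injective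
    ((hσ.range_inj strictMono_id).1 (by simp [σ.surjective.range_eq]))
  exact ⟨h1, by simpa [h1] using h⟩

theorem partitionFunctional_empty_alternant {k : ℕ} {α β : Fin k → ℕ} (hα : StrictAnti α)
    (hβ : StrictAnti β) :
    partitionFunctional ∅ (fun i => (β i : ℤ)) (alternant k α) = if α = β then 1 else 0 := by
  rw [alternant_eq_sum_monomial, map_sum]
  have hzero : ∀ σ : Equiv.Perm (Fin k),
      (fun i => (((α ∘ σ) i : ℕ) : ℤ) - (β i : ℤ)) = 0 ↔ σ = 1 ∧ α = β := by
    intro σ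
    rw [← comp_perm_eq_iff hα hβ, funext_iff, funext_iff]
    simp [sub_eq_zero]
  simp only [map_smul, partitionFunctional_monomial, ncard_partitionSet_empty,
    Finsupp.equivFunOnFinite_symm_apply_apply, hzero, ite_and]
  rw [Finset.sum_eq_single 1]
  · simp
  · intro σ _ hσ
    simp [hσ]
  · simp

theorem finite_support_of_sum_eq {k : ℕ} {f : (Fin k → ℕ) → ℕ} {N : ℕ}
    (hf : ∀ κ, f κ ≠ 0 → ∑ i, κ i = N) : f.support.Finite := by
  refine (Set.finite_Iic (fun _ : Fin k => N)).subset fun κ hκ i => ?_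
  rw [← hf κ hκ]
  exact Finset.single_le_sum (fun _ _ => Nat.zero_le _) (Finset.mem_univ i)

/-- Steinberg's formula:
`C^ν_{λ,μ} = Σ_{σ,τ ∈ S_k} (-1)^{inv(στ)} K(σ(λ+δ) + τ(μ+δ) - (ν+2δ))`. -/
theorem stmt3 (k : ℕ) (hk : 0 < k)
    (lr : (Fin k → ℕ) → (Fin k → ℕ) → (Fin k → ℕ) → ℕ) (hlr : IsLRCoeffFamily k lr)
    (lam mu ν : Fin k → ℕ) (hlam : Antitone lam) (hmu : Antitone mu) (hν : Antitone ν)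
    (hsum : ∑ i, ν i = ∑ i, lam i + ∑ i, mu i) :
    (lr ν lam mu : ℤ) =
      ∑ σ : Equiv.Perm (Fin k), ∑ τ : Equiv.Perm (Fin k),
        (-1 : ℤ) ^ inversions (σ * τ) *
          (kostant k (fun i =>
            ((lam (σ i) : ℚ) + halfδ k (σ i)) + ((mu (τ i) : ℚ) + halfδ k (τ i))
              - ((ν i : ℚ) + 2 * halfδ k i)) : ℤ) := by
  set w : Fin k → ℤ := fun i => (ν i : ℤ) + 2 * staircase k i with hw
  have hfin : (fun κ => lr κ lam mu).support.Finite :=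
    finite_support_of_sum_eq fun κ hκ => (hlr.1 κ lam mu hκ).2
  have key := congrArg (partitionFunctional (positivePairs k) w) (hlr.2 lam mu hlam hmu)
  rw [alternant_staircase, partitionFunctional_prod_mul subset_rfl, sum_positivePairs_single,
    finsum_eq_sum_of_support_subset (s := hfin.toFinset) _ (by
      intro κ hκ
      rw [Set.Finite.coe_toFinset]
      exact fun h => hκ (by simp [h])), map_sum] at key
  have hshift : w - (fun i => (staircase k i : ℤ)) =
      fun i => (((ν + staircase k) i : ℕ) : ℤ) := by
    ext i
    simp [hw]
    ring
  have hright : ∑ κ ∈ hfin.toFinset, partitionFunctional ∅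
      (w - fun i => (staircase k i : ℤ)) (lr κ lam mu • alternant k (κ + staircase k)) =
      lr ν lam mu := by
    have hterm : ∀ κ ∈ hfin.toFinset, partitionFunctional ∅
        (w - fun i => (staircase k i : ℤ)) (lr κ lam mu • alternant k (κ + staircase k)) =
        if κ = ν then (lr κ lam mu : ℤ) else 0 := by
      intro κ hκ
      have hanti := (hlr.1 κ lam mu (by simpa using hκ)).1
      rw [map_nsmul, hshift, partitionFunctional_empty_alternant
        (strictAnti_add_staircase hanti) (strictAnti_add_staircase hν)]
      simp
    rw [Finset.sum_congr rfl hterm, Finset.sum_ite_eq']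
    by_cases h : lr ν lam mu = 0 <;> simp [h]
  rw [hright] at key
  rw [← key, alternant_eq_sum_monomial, alternant_eq_sum_monomial, Finset.sum_mul_sum, map_sum]
  refine Finset.sum_congr rfl fun σ _ => ?_
  rw [map_sum]
  refine Finset.sum_congr rfl fun τ _ => ?_
  rw [neg_one_pow_inversions, Equiv.Perm.sign_mul, smul_mul_smul_comm,
    MvPolynomial.monomial_mul, one_mul, map_smul, partitionFunctional_monomial,
    ← kostant_intCast, smul_eq_mul, Units.val_mul]
  congr 3
  ext i
  have hcast : ∀ j : Fin k, (staircase k j : ℚ) = halfδ k j + ((k : ℚ) - 1) / 2 := by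
    intro j
    rw [staircase, halfδ, Nat.sub_sub, Nat.cast_sub (by omega)]
    push_cast
    ring
  simp [hw, hcast]
  ring
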